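/- Regret bound for dual averaging (Theorem 3). Let η : ℕ → ℝ_{>0} be nonincreasing. Let {f_t}_{t≥1} be convex functions f_t : X → ℝ. Suppose sequences {x_t}_{t≥1} ⊆ X ∩ D, {y_t}_{t≥2} ⊆ D, {w_t}_{t≥2} ⊆ D and {g_t}_{t≥1} ⊆ ℝⁿ satisfy, for every t ≥ 1: g_t is a subgradient of f_t at x_t on X; ∇Φ(y_{t+1}) = ∇Φ(x_1) − η_{t+1} Σ_{i=1}^t g_i; x_{t+1} ∈ X ∩ D satisfies D_Φ(x_{t+1}, y_{t+1}) ≤ D_Φ(x, y_{t+1}) for all x ∈ X; and ∇Φ(w_{t+1}) = ∇Φ(x_t) − η_t g_t. Then for every T ≥ 1 and every z ∈ X: Σ_{t=1}^T (f_t(x_t) − f_t(z)) ≤ Σ_{t=1}^T (D_Φ(x_t, w_{t+1}) − D_Φ(x_{t+1}, w_{t+1}))/η_t + D_Φ(z, x_1)/η_{T+1}. -/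

import Mathlib

/-! Regret bound for dual averaging (Theorem 3). -/

open scoped RealInnerProductSpace BigOperators

/-- Bregman divergence `D_Φ(x,y) = Φ(x) − Φ(y) − ⟨∇Φ(y), x − y⟩`. -/
noncomputable def bregman {n : ℕ} (Φ : EuclideanSpace ℝ (Fin n) → ℝ)
    (Φ' : EuclideanSpace ℝ (Fin n) → EuclideanSpace ℝ (Fin n))
    (x y : EuclideanSpace ℝ (Fin n)) : ℝ :=
  Φ x - Φ y - ⟪Φ' y, x - y⟫

theorem bregman_nonneg_aux {n : ℕ} {D : Set (EuclideanSpace ℝ (Fin n))}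
    {Φ : EuclideanSpace ℝ (Fin n) → ℝ} {p u v : EuclideanSpace ℝ (Fin n)}
    (hc : ConvexOn ℝ D Φ) (hu : u ∈ D) (hv : v ∈ D) (hg : HasGradientAt Φ p v) :
    0 ≤ Φ u - Φ v - ⟪p, u - v⟫ := by
  have h1 : ConvexOn ℝ (Set.Icc (0:ℝ) 1) (fun s => Φ (AffineMap.lineMap v u s)) := by
    refine (hc.comp_affineMap (AffineMap.lineMap v u)).subset ?_ (convex_Icc 0 1)
    intro s hs
    exact hc.1.segment_subset hv hu (by
      rw [segment_eq_image_lineMap]; exact ⟨s, hs, rfl⟩)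
  have h2 : HasDerivAt (fun s : ℝ => Φ (AffineMap.lineMap v u s)) ⟪p, u - v⟫ 0 := by
    have h3 : HasDerivAt (fun s : ℝ => (AffineMap.lineMap v u s : EuclideanSpace ℝ (Fin n)))
        (u - v) 0 := AffineMap.hasDerivAt_lineMap
    have h4 : HasFDerivAt Φ (InnerProductSpace.toDual ℝ _ p)
        (AffineMap.lineMap v u (0:ℝ)) := by
      simpa using hg.hasFDerivAt
    simpa [Function.comp_def] using h4.comp_hasDerivAt (0:ℝ) h3
  have h5 := h1.le_slope_of_hasDerivAt (x := 0) (y := 1) (by simp) (by simp) (by norm_num) h2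
  simp [slope_def_field] at h5
  linarith

theorem opt_aux {n : ℕ} {X : Set (EuclideanSpace ℝ (Fin n))}
    {Φ : EuclideanSpace ℝ (Fin n) → ℝ} {p q u v : EuclideanSpace ℝ (Fin n)}
    (hX : Convex ℝ X) (hu : u ∈ X) (hv : v ∈ X) (hg : HasGradientAt Φ p v)
    (hm : ∀ u ∈ X, Φ v - ⟪q, v⟫ ≤ Φ u - ⟪q, u⟫) :
    0 ≤ ⟪p - q, u - v⟫ := by
  have h1 : IsLocalMinOn (fun u => Φ u - ⟪q, u⟫) X v :=
    (show IsMinOn (fun u => Φ u - ⟪q, u⟫) X v from fun u hu => hm u hu).localize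
  have h2 : HasFDerivAt (fun u => Φ u - ⟪q, u⟫)
      (InnerProductSpace.toDual ℝ _ p - InnerProductSpace.toDual ℝ _ q) v :=
    hg.hasFDerivAt.sub (InnerProductSpace.toDual ℝ _ q).hasFDerivAt
  have h3 := h1.hasFDerivWithinAt_nonneg h2.hasFDerivWithinAt
    (sub_mem_posTangentConeAt_of_segment_subset (hX.segment_subset hv hu))
  simpa [inner_sub_left] using h3

theorem dual_averaging_regret_bound {n : ℕ}
    (D X : Set (EuclideanSpace ℝ (Fin n)))
    (Φ : EuclideanSpace ℝ (Fin n) → ℝ)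
    (Φ' : EuclideanSpace ℝ (Fin n) → EuclideanSpace ℝ (Fin n))
    -- mirror map setup
    (hDopen : IsOpen D) (hDconv : Convex ℝ D) (hDne : D.Nonempty)
    (hΦconv : ConvexOn ℝ (closure D) Φ)
    (hΦstrict : StrictConvexOn ℝ D Φ)
    (hΦgrad : ∀ y ∈ D, HasGradientAt Φ (Φ' y) y)
    (hΦbij : Set.BijOn Φ' D Set.univ)
    (hXclosed : IsClosed X) (hXconv : Convex ℝ X)
    (hXsub : X ⊆ closure D) (hXDne : (X ∩ D).Nonempty)
    -- learning rates
    (η : ℕ → ℝ) (hη : ∀ t, 0 < η t) (hηmono : ∀ t, η (t + 1) ≤ η t)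
    -- cost functions
    (f : ℕ → EuclideanSpace ℝ (Fin n) → ℝ)
    (hfconv : ∀ t, 1 ≤ t → ConvexOn ℝ X (f t))
    -- iterates of dual averaging
    (x y w g : ℕ → EuclideanSpace ℝ (Fin n))
    (hx : ∀ t, 1 ≤ t → x t ∈ X ∩ D)
    (hy : ∀ t, 2 ≤ t → y t ∈ D)
    (hw : ∀ t, 2 ≤ t → w t ∈ D)
    (hsubgrad : ∀ t, 1 ≤ t → ∀ z ∈ X, f t (x t) + ⟪g t, z - x t⟫ ≤ f t z)
    (hystep : ∀ t, 1 ≤ t →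
      Φ' (y (t + 1)) = Φ' (x 1) - η (t + 1) • ∑ i ∈ Finset.Icc 1 t, g i)
    (hproj : ∀ t, 1 ≤ t → ∀ u ∈ X,
      bregman Φ Φ' (x (t + 1)) (y (t + 1)) ≤ bregman Φ Φ' u (y (t + 1)))
    (hwstep : ∀ t, 1 ≤ t → Φ' (w (t + 1)) = Φ' (x t) - η t • g t) :
    ∀ T, 1 ≤ T → ∀ z ∈ X,
      ∑ t ∈ Finset.Icc 1 T, (f t (x t) - f t z) ≤
        ∑ t ∈ Finset.Icc 1 T,
          (bregman Φ Φ' (x t) (w (t + 1)) - bregman Φ Φ' (x (t + 1)) (w (t + 1))) / η t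
        + bregman Φ Φ' z (x 1) / η (T + 1) := by
  have hbn : ∀ t, 1 ≤ t → 0 ≤ bregman Φ Φ' (x t) (x 1) := fun t ht =>
    bregman_nonneg_aux hΦstrict.convexOn (hx t ht).2 (hx 1 le_rfl).2
      (hΦgrad _ (hx 1 le_rfl).2)
  have hopt : ∀ t, ∀ u ∈ X,
      0 ≤ ⟪Φ' (x (t + 1)) - (Φ' (x 1) - η (t + 1) • ∑ i ∈ Finset.Icc 1 t, g i),
        u - x (t + 1)⟫ := by
    intro t u hu
    rcases Nat.eq_zero_or_pos t with rfl | ht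
    · simp
    · refine opt_aux hXconv hu (hx (t + 1) (by omega)).1
        (hΦgrad _ (hx (t + 1) (by omega)).2) ?_
      intro u hu
      have := hproj t ht u hu
      simp only [bregman, inner_sub_right, hystep t ht] at this
      linarith
  have key : ∀ T, ∑ t ∈ Finset.Icc 1 T,
      (⟪g t, x (t + 1)⟫ + bregman Φ Φ' (x (t + 1)) (x t) / η t) ≤
      ⟪∑ i ∈ Finset.Icc 1 T, g i, x (T + 1)⟫
        + bregman Φ Φ' (x (T + 1)) (x 1) / η (T + 1) := by
    intro T
    induction T with
    | zero => simp [bregman]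
    | succ T ih =>
      rw [Finset.sum_Icc_succ_top (by omega), Finset.sum_Icc_succ_top (by omega)]
      have h1 := hopt T (x (T + 1 + 1)) (hx _ (by omega)).1
      set G := ∑ i ∈ Finset.Icc 1 T, g i
      have h2 : bregman Φ Φ' (x (T + 1 + 1)) (x 1) / η (T + 1) ≤
          bregman Φ Φ' (x (T + 1 + 1)) (x 1) / η (T + 1 + 1) :=
        div_le_div_of_nonneg_left (hbn _ (by omega)) (hη _) (hηmono _)
      have h3 : (bregman Φ Φ' (x (T + 1 + 1)) (x (T + 1)) + bregman Φ Φ' (x (T + 1)) (x 1)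
          - bregman Φ Φ' (x (T + 1 + 1)) (x 1)) / η (T + 1)
          ≤ ⟪G, x (T + 1 + 1)⟫ - ⟪G, x (T + 1)⟫ := by
        rw [div_le_iff₀ (hη _)]
        simp only [bregman, inner_sub_left, inner_sub_right, real_inner_smul_left] at h1 ⊢
        linarith
      rw [sub_div, add_div] at h3
      rw [inner_add_left]
      linarith
  intro T hT z hz
  have h1 : ∀ t ∈ Finset.Icc 1 T, f t (x t) - f t z ≤
      (bregman Φ Φ' (x t) (w (t + 1)) - bregman Φ Φ' (x (t + 1)) (w (t + 1))) / η t
      + (⟪g t, x (t + 1)⟫ + bregman Φ Φ' (x (t + 1)) (x t) / η t) - ⟪g t, z⟫ := by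
    intro t ht
    have ht := (Finset.mem_Icc.1 ht).1
    have h2 := hsubgrad t ht z hz
    have h3 : (bregman Φ Φ' (x t) (w (t + 1)) - bregman Φ Φ' (x (t + 1)) (w (t + 1))) / η t
        = ⟪g t, x t⟫ - ⟪g t, x (t + 1)⟫ - bregman Φ Φ' (x (t + 1)) (x t) / η t := by
      have := (hη t).ne'
      field_simp
      simp only [bregman, hwstep t ht, inner_sub_left, inner_sub_right, real_inner_smul_left]
      ring
    rw [inner_sub_right] at h2
    rw [h3]
    linarith
  have h2 := Finset.sum_le_sum h1
  refine h2.trans ?_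
  rw [Finset.sum_sub_distrib, Finset.sum_add_distrib, ← sum_inner]
  have h3 := key T
  have h4 : (bregman Φ Φ' (x (T + 1)) (x 1) - bregman Φ Φ' z (x 1)) / η (T + 1)
      ≤ ⟪∑ i ∈ Finset.Icc 1 T, g i, z⟫ - ⟪∑ i ∈ Finset.Icc 1 T, g i, x (T + 1)⟫ := by
    rw [div_le_iff₀ (hη _)]
    have := hproj T hT z hz
    simp only [bregman, hystep T hT, inner_sub_left, inner_sub_right,
      real_inner_smul_left] at this ⊢
    linarith
  rw [sub_div] at h4
  linarith
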